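/- Under the assumptions of the main density estimate, for each ball radius R > 0, bounded drift b with ‖b‖_∞√t ≤ 1 and t ∈ [0,1]: ∫_{ℝ^d} E^y[|K(x − X^b_t)| 1_{|x−X^b_t| ≤ R}] |w(y)| dy ≤ (2α C^{1+d/2} π^d R^{d−γ} ‖w‖_∞) / (Γ(d/2)(d−γ)) · (1 + ‖b‖_∞ √t e^{ξ‖b‖_∞² t/(2(q−1))}), for all x ∈ ℝ^d, where |K(x)| ≤ α/|x|^γ, γ ∈ [0,d), and w ∈ L¹ ∩ L^∞(ℝ^d). -/

import Mathlib

open Real MeasureTheory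

open Set in
lemma aux_radial_pt (d : ℕ) (hd : 1 ≤ d) (α γ R y : ℝ) (hy : 0 < y) :
    y ^ (d - 1) • (if y ≤ R then α / y ^ γ else 0) =
      (Iic R).indicator (fun y => α * y ^ ((d : ℝ) - γ - 1)) y := by
  by_cases h : y ≤ R
  · rw [indicator_of_mem (by exact h), if_pos h, smul_eq_mul, ← Real.rpow_natCast,
      Nat.cast_sub hd, Nat.cast_one, show (d : ℝ) - γ - 1 = (d - 1) - γ by ring,
      Real.rpow_sub hy _ γ]
    ring
  · rw [indicator_of_notMem (by exact h), if_neg h, smul_zero]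

open Set in
lemma aux_radial_integrable (d : ℕ) (hd : 1 ≤ d) (α γ R : ℝ) (hγd : γ < d) (hR : 0 < R) :
    Integrable (fun z : EuclideanSpace ℝ (Fin d) => if ‖z‖ ≤ R then α / ‖z‖ ^ γ else 0) := by
  have : Nonempty (Fin d) := ⟨⟨0, hd⟩⟩
  rw [integrable_fun_norm_addHaar volume (f := fun r : ℝ => if r ≤ R then α / r ^ γ else 0)]
  rw [finrank_euclideanSpace_fin]
  rw [integrableOn_congr_fun (s := Ioi (0 : ℝ)) (fun y hy => aux_radial_pt d hd α γ R y hy) measurableSet_Ioi]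
  rw [integrableOn_indicator_iff measurableSet_Iic, inter_comm, Ioi_inter_Iic]
  have := (intervalIntegral.intervalIntegrable_rpow' (a := 0) (b := R)
    (r := (d : ℝ) - γ - 1) (by linarith)).const_mul α
  rwa [intervalIntegrable_iff_integrableOn_Ioc_of_le hR.le] at this

open Set in
lemma aux_radial_integral (d : ℕ) (hd : 1 ≤ d) (α γ R : ℝ) (hγd : γ < d) (hR : 0 < R) :
    ∫ z : EuclideanSpace ℝ (Fin d), (if ‖z‖ ≤ R then α / ‖z‖ ^ γ else 0) =
      2 * π ^ ((d : ℝ) / 2) / Real.Gamma ((d : ℝ) / 2) * (α * R ^ ((d : ℝ) - γ) / (d - γ)) := by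
  have : Nonempty (Fin d) := ⟨⟨0, hd⟩⟩
  have hd' : (0 : ℝ) < d := by exact_mod_cast hd
  rw [integral_fun_norm_addHaar volume (fun r : ℝ => if r ≤ R then α / r ^ γ else 0)]
  rw [finrank_euclideanSpace_fin]
  rw [setIntegral_congr_fun measurableSet_Ioi (fun y hy => aux_radial_pt d hd α γ R y hy)]
  rw [setIntegral_indicator measurableSet_Iic, Ioi_inter_Iic,
    ← intervalIntegral.integral_of_le hR.le, intervalIntegral.integral_const_mul,
    integral_rpow (Or.inl (by linarith))]
  rw [Measure.real, EuclideanSpace.volume_ball]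
  have hG := Real.Gamma_pos_of_pos (half_pos hd')
  have hs : √π ^ d = π ^ ((d : ℝ) / 2) := by
    rw [Real.sqrt_eq_rpow, ← Real.rpow_natCast, ← Real.rpow_mul pi_nonneg]; ring_nf
  have h1 : (d : ℝ) - γ ≠ 0 := by linarith
  rw [Fintype.card_fin, Real.Gamma_add_one (by positivity), hs, ENNReal.ofReal_one, one_pow,
    one_mul, ENNReal.toReal_ofReal (by positivity), sub_add_cancel, Real.zero_rpow h1]
  simp only [nsmul_eq_mul, smul_eq_mul, sub_zero]
  field_simp

lemma aux_gauss (d : ℕ) (s : ℝ) (hs : 0 < s) :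
    Integrable (fun z : EuclideanSpace ℝ (Fin d) => Real.exp (-‖z‖ ^ 2 / s)) ∧
    ∫ z : EuclideanSpace ℝ (Fin d), Real.exp (-‖z‖ ^ 2 / s) = (π * s) ^ ((d : ℝ) / 2) := by
  have h : ∫ z : EuclideanSpace ℝ (Fin d), Real.exp (-‖z‖ ^ 2 / s) = (π * s) ^ ((d : ℝ) / 2) := by
    have := GaussianFourier.integral_rexp_neg_mul_sq_norm (V := EuclideanSpace ℝ (Fin d))
      (inv_pos.2 hs)
    rw [finrank_euclideanSpace_fin, div_inv_eq_mul] at this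
    rw [← this]
    congr with z
    congr 1
    field_simp
  refine ⟨?_, h⟩
  by_contra hn
  rw [integral_undef hn] at h
  have : 0 < (π * s) ^ ((d : ℝ) / 2) := by positivity
  linarith

/-- Small-ball bound for the kernel expectation under the main density estimate:
`∫ E^y[|K(x−X^b_t)| 1_{|x−X^b_t|≤R}] |w(y)| dy
  ≤ (2αC^{1+d/2}π^d R^{d−γ}‖w‖_∞)/(Γ(d/2)(d−γ)) (1 + ‖b‖_∞√t e^{ξ‖b‖_∞²t/(2(q−1))})`. -/
theorem stmt_17 (d : ℕ) (hd : 1 ≤ d) (α γ ξ q κ C B t R Winf : ℝ)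
    (hα : 0 < α) (hγ0 : 0 ≤ γ) (hγd : γ < d) (hξ : 0 < ξ) (hq : 1 < q)
    (hκ : 0 < κ) (hκC : κ ≤ C) (hB : 0 ≤ B) (ht0 : 0 < t) (ht1 : t ≤ 1)
    (hBt : B * Real.sqrt t ≤ 1) (hR : 0 < R) (hW : 0 ≤ Winf)
    (K : EuclideanSpace ℝ (Fin d) →
      (EuclideanSpace ℝ (Fin d) →L[ℝ] EuclideanSpace ℝ (Fin d)))
    (hK : ∀ x, x ≠ 0 → ‖K x‖ ≤ α / ‖x‖ ^ γ)
    (p pb : EuclideanSpace ℝ (Fin d) → EuclideanSpace ℝ (Fin d) → ℝ)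
    (hpb0 : ∀ y z, 0 ≤ pb y z)
    -- Aronson upper bound for `p(y,t,·)`
    (hAr : ∀ y z, p y z ≤ κ / t ^ ((d : ℝ) / 2) * Real.exp (-‖z - y‖ ^ 2 / (κ * t)))
    -- main density estimate for `p_b(y,t,·)`
    (hpb : ∀ y z, pb y z ≤ p y z +
      B * Real.sqrt t * Real.exp (ξ * B ^ 2 * t / (2 * (q - 1))) *
        (C / t ^ ((d : ℝ) / 2)) * Real.exp (-‖z - y‖ ^ 2 / (C * t)))
    (w : EuclideanSpace ℝ (Fin d) → ℝ) (hw : ∀ y, |w y| ≤ Winf)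
    (x : EuclideanSpace ℝ (Fin d)) :
    ∫ y, (∫ z, (if ‖x - z‖ ≤ R then ‖K (x - z)‖ else 0) * pb y z) * |w y| ≤
      2 * α * C ^ (1 + (d : ℝ) / 2) * π ^ d * R ^ ((d : ℝ) - γ) * Winf /
          (Real.Gamma ((d : ℝ) / 2) * ((d : ℝ) - γ)) *
        (1 + B * Real.sqrt t * Real.exp (ξ * B ^ 2 * t / (2 * (q - 1)))) := by
  have hC : 0 < C := lt_of_lt_of_le hκ hκC
  have : Nonempty (Fin d) := ⟨⟨0, hd⟩⟩
  set D : ℝ := B * Real.sqrt t * Real.exp (ξ * B ^ 2 * t / (2 * (q - 1))) with hD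
  have hD0 : 0 ≤ D := by positivity
  set g : EuclideanSpace ℝ (Fin d) → ℝ := fun z => if ‖z‖ ≤ R then α / ‖z‖ ^ γ else 0 with hg
  set G : EuclideanSpace ℝ (Fin d) → ℝ := fun z => Real.exp (-‖z‖ ^ 2 / (C * t)) with hG
  have hg0 : ∀ z, 0 ≤ g z := fun z => by
    simp only [hg]; split_ifs <;> positivity
  have hG0 : ∀ z, 0 ≤ G z := fun z => (Real.exp_pos _).le
  have hG1 : ∀ z, G z ≤ 1 := fun z => by
    apply Real.exp_le_one_iff.2
    rw [neg_div]
    have : 0 ≤ ‖z‖ ^ 2 / (C * t) := by positivity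
    linarith
  have hGc : Continuous G := by simp only [hG]; fun_prop
  have hgi : Integrable g := aux_radial_integrable d hd α γ R hγd hR
  have hgI := aux_radial_integral d hd α γ R hγd hR
  obtain ⟨hGi, hGI⟩ := aux_gauss d (C * t) (by positivity)
  set M : ℝ := (1 + D) * (C / t ^ ((d : ℝ) / 2)) with hM
  have hM0 : 0 ≤ M := by positivity
  -- pointwise density bound
  have hdens : ∀ y z, pb y z ≤ M * G (x - y - (x - z)) := by
    intro y z
    have e : x - y - (x - z) = z - y := by abel
    rw [e]
    have h1 := hpb y z
    have h2 := hAr y z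
    have h3 : κ / t ^ ((d : ℝ) / 2) * Real.exp (-‖z - y‖ ^ 2 / (κ * t)) ≤
        C / t ^ ((d : ℝ) / 2) * G (z - y) := by
      simp only [hG, neg_div]
      gcongr
    have : M * G (z - y) = C / t ^ ((d : ℝ) / 2) * G (z - y) +
      D * (C / t ^ ((d : ℝ) / 2)) * G (z - y) := by rw [hM]; ring
    rw [this]
    linarith
  let H : EuclideanSpace ℝ (Fin d) → ℝ :=
    convolution g G (ContinuousLinearMap.mul ℝ ℝ) volume
  have hHi : Integrable H := hgi.integrable_convolution _ hGi
  have hHI : ∫ y, H y = (∫ z, g z) * ∫ z, G z := by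
    simpa using integral_convolution (ContinuousLinearMap.mul ℝ ℝ) hgi hGi
  have hH : ∀ y, H (x - y) = ∫ z, g (x - z) * G (x - y - (x - z)) := by
    intro y
    rw [integral_sub_left_eq_self (fun u => g u * G (x - y - u)) volume x]
    rfl
  have hH0 : ∀ y, 0 ≤ H y := fun y => integral_nonneg fun z => mul_nonneg (hg0 _) (hG0 _)
  have hinner : ∀ y, (∫ z, (if ‖x - z‖ ≤ R then ‖K (x - z)‖ else 0) * pb y z) ≤
      M * H (x - y) := by
    intro y
    rw [hH, ← integral_const_mul]
    apply integral_mono_of_nonneg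
    · refine Filter.Eventually.of_forall fun z => mul_nonneg ?_ (hpb0 _ _)
      try dsimp only
      split_ifs <;> positivity
    · apply Integrable.const_mul
      have : Integrable (fun u => g u * G (x - y - u)) := by
        refine hgi.mul_bdd (c := 1) (by fun_prop) (Filter.Eventually.of_forall fun z => ?_)
        rw [Real.norm_of_nonneg (hG0 _)]
        exact hG1 _
      exact this.comp_sub_left x
    · have hne : ∀ᵐ z : EuclideanSpace ℝ (Fin d), z ≠ x :=
        compl_mem_ae_iff.2 (measure_singleton x)
      filter_upwards [hne] with z hz
      have h1 : (if ‖x - z‖ ≤ R then ‖K (x - z)‖ else 0) ≤ g (x - z) := by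
        simp only [hg]
        split_ifs
        · exact hK _ (sub_ne_zero.2 hz.symm)
        · exact le_rfl
      calc _ ≤ g (x - z) * (M * G (x - y - (x - z))) :=
            mul_le_mul h1 (hdens y z) (hpb0 _ _) (hg0 _)
        _ = _ := by ring
  have hfin : ∫ y, (∫ z, (if ‖x - z‖ ≤ R then ‖K (x - z)‖ else 0) * pb y z) * |w y| ≤
      ∫ y, M * H (x - y) * Winf := by
    apply integral_mono_of_nonneg
    · refine Filter.Eventually.of_forall fun y => mul_nonneg (integral_nonneg fun z =>
        mul_nonneg ?_ (hpb0 _ _)) (abs_nonneg _)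
      try dsimp only
      split_ifs <;> positivity
    · exact ((hHi.comp_sub_left x).const_mul M).mul_const Winf
    · exact Filter.Eventually.of_forall fun y =>
        mul_le_mul (hinner y) (hw y) (abs_nonneg _) (mul_nonneg hM0 (hH0 _))
  refine hfin.trans (le_of_eq ?_)
  rw [integral_mul_const, integral_const_mul, integral_sub_left_eq_self H volume x, hHI]
  rw [show (∫ z, g z) = _ from hgI, show (∫ z, G z) = _ from hGI, hM]
  have hGam := Real.Gamma_pos_of_pos (show (0 : ℝ) < (d : ℝ) / 2 by positivity)
  have h1 : (d : ℝ) - γ ≠ 0 := by linarith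
  have hp : π ^ d = π ^ ((d : ℝ) / 2) * π ^ ((d : ℝ) / 2) := by
    rw [← Real.rpow_add pi_pos, add_halves, Real.rpow_natCast]
  have htp : 0 < t ^ ((d : ℝ) / 2) := by positivity
  rw [Real.mul_rpow pi_nonneg (by positivity), Real.mul_rpow hC.le ht0.le, hp,
    Real.rpow_add hC, Real.rpow_one]
  field_simp
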